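/- Let G be a torsion-free groupoid (a groupoid such that for every object a the isotropy group G(a) is torsion-free) and let S be a ring that is strongly G-graded and object unital. Then S is left (respectively right) artinian if and only if G_0 is finite and for every a ∈ G_0 the ring S_a is left (respectively right) artinian and S_{G(a)} is finitely generated as a left (respectively right) S_a-module. -/

import Mathlib

open CategoryTheory

namespace ChainPaper

section NonUnital

variable {S : Type*} [NonUnitalRing S]

/-- The additive subgroup `e S f = {e * s * f | s ∈ S}` of a non-unital ring `S`. -/
def corner (e f : S) : AddSubgroup S :=
  ((AddMonoidHom.mulLeft e).comp (AddMonoidHom.mulRight f)).range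

/-- The additive subgroup `S e = {s * e | s ∈ S}`. -/
def rightMulRange (e : S) : AddSubgroup S := (AddMonoidHom.mulRight e).range

/-- The additive subgroup `e S = {e * s | s ∈ S}`. -/
def leftMulRange (e : S) : AddSubgroup S := (AddMonoidHom.mulLeft e).range

/-- The product of two additive subgroups of a ring: the additive subgroup generated by
all products `a * b` with `a ∈ A`, `b ∈ B`. -/
def sMul (A B : AddSubgroup S) : AddSubgroup S :=
  AddSubgroup.closure {x | ∃ a ∈ A, ∃ b ∈ B, x = a * b}

/-- `I` is a left ideal of the (possibly non-unital) subring whose carrier is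
the additive subgroup `C` (closed under multiplication). -/
def IsLeftIdealIn (C I : AddSubgroup S) : Prop :=
  I ≤ C ∧ ∀ s ∈ C, ∀ x ∈ I, s * x ∈ I

def IsRightIdealIn (C I : AddSubgroup S) : Prop :=
  I ≤ C ∧ ∀ s ∈ C, ∀ x ∈ I, x * s ∈ I

/-- `M` is a left `C`-submodule of `H` (both viewed inside the ambient ring `S`,
with `C` acting by left multiplication). -/
def IsLeftSubmoduleIn (C H M : AddSubgroup S) : Prop :=
  M ≤ H ∧ ∀ s ∈ C, ∀ x ∈ M, s * x ∈ M

def IsRightSubmoduleIn (C H M : AddSubgroup S) : Prop :=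
  M ≤ H ∧ ∀ s ∈ C, ∀ x ∈ M, x * s ∈ M

/-- The descending chain condition on the subcollection of additive subgroups of `S`
cut out by the predicate `P`. -/
def DCCOn (P : AddSubgroup S → Prop) : Prop :=
  ∀ f : ℕ → AddSubgroup S, (∀ n, P (f n)) → (∀ n, f (n + 1) ≤ f n) →
    ∃ n, ∀ m, n ≤ m → f m = f n

/-- The ascending chain condition on the subcollection of additive subgroups of `S`
cut out by the predicate `P`. -/
def ACCOn (P : AddSubgroup S → Prop) : Prop :=
  ∀ f : ℕ → AddSubgroup S, (∀ n, P (f n)) → (∀ n, f n ≤ f (n + 1)) →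
    ∃ n, ∀ m, n ≤ m → f m = f n

def LeftArtinianOn (C : AddSubgroup S) : Prop := DCCOn (IsLeftIdealIn C)
def RightArtinianOn (C : AddSubgroup S) : Prop := DCCOn (IsRightIdealIn C)
def LeftNoetherianOn (C : AddSubgroup S) : Prop := ACCOn (IsLeftIdealIn C)
def RightNoetherianOn (C : AddSubgroup S) : Prop := ACCOn (IsRightIdealIn C)

end NonUnital

/-- A possibly non-unital ring is left artinian if its poset of left ideals
satisfies the descending chain condition. -/
def IsLeftArtinian (S : Type*) [NonUnitalRing S] : Prop := LeftArtinianOn (⊤ : AddSubgroup S)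
def IsRightArtinian (S : Type*) [NonUnitalRing S] : Prop := RightArtinianOn (⊤ : AddSubgroup S)
def IsLeftNoetherian (S : Type*) [NonUnitalRing S] : Prop := LeftNoetherianOn (⊤ : AddSubgroup S)
def IsRightNoetherian (S : Type*) [NonUnitalRing S] : Prop := RightNoetherianOn (⊤ : AddSubgroup S)

section NonUnital2

variable {S : Type*} [NonUnitalRing S]

/-- `{e i}_{i ∈ ι}` is a complete set of idempotents for `S`: the `e i` are nonzero
pairwise orthogonal idempotents and `S = ⊕ᵢ S eᵢ = ⊕ᵢ eᵢ S` as internal direct sums of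
additive subgroups. -/
structure IsCompleteIdempotents {ι : Type*} (e : ι → S) : Prop where
  ne_zero : ∀ i, e i ≠ 0
  idem : ∀ i, e i * e i = e i
  orthogonal : ∀ i j, i ≠ j → e i * e j = 0
  indep_right : iSupIndep fun i => rightMulRange (e i)
  span_right : (⨆ i, rightMulRange (e i)) = ⊤
  indep_left : iSupIndep fun i => leftMulRange (e i)
  span_left : (⨆ i, leftMulRange (e i)) = ⊤

/-- A complete set of idempotents is strong if for all `p q`, whenever one of
`eₚ S e_q` and `e_q S eₚ` is nonzero, then the other is nonzero and `eₚ ∈ (eₚ S e_q)(e_q S eₚ)`. -/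
def IsStrongIdempotents {ι : Type*} (e : ι → S) : Prop :=
  ∀ p q : ι,
    (corner (e p) (e q) ≠ ⊥ ∨ corner (e q) (e p) ≠ ⊥) →
      corner (e p) (e q) ≠ ⊥ ∧ corner (e q) (e p) ≠ ⊥ ∧
        e p ∈ sMul (corner (e p) (e q)) (corner (e q) (e p))

/-- `H` is finitely generated as a left module over `C` (inside the ambient ring `S`,
`C` acting by left multiplication). -/
def IsFGLeftModuleIn (C H : AddSubgroup S) : Prop :=
  ∃ F : Finset S, ↑F ⊆ (H : Set S) ∧
    ∀ x ∈ H, x ∈ sInf {M : AddSubgroup S | ↑F ⊆ (M : Set S) ∧ ∀ s ∈ C, ∀ y ∈ M, s * y ∈ M}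

def IsFGRightModuleIn (C H : AddSubgroup S) : Prop :=
  ∃ F : Finset S, ↑F ⊆ (H : Set S) ∧
    ∀ x ∈ H, x ∈ sInf {M : AddSubgroup S | ↑F ⊆ (M : Set S) ∧ ∀ s ∈ C, ∀ y ∈ M, y * s ∈ M}

end NonUnital2

/-- A small category `G` is hom-set strong if for all objects `x y`, whenever one of
`G(x,y)` and `G(y,x)` is nonempty (here `G(x,y)` denotes the set of morphisms `y → x`),
then the other is nonempty and `𝟙 x ∈ G(x,y)G(y,x)`. -/
def HomSetStrong (G : Type*) [Category G] : Prop :=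
  ∀ x y : G, (Nonempty (y ⟶ x) ∨ Nonempty (x ⟶ y)) →
    Nonempty (y ⟶ x) ∧ Nonempty (x ⟶ y) ∧ ∃ (g : y ⟶ x) (h : x ⟶ y), h ≫ g = 𝟙 x

/-- An object unital grading of the (possibly non-unital) ring `S` by the small category `G`:
`S = ⊕_{g ∈ G₁} S_g` with `S_g S_h ⊆ S_{g ∘ h}` for composable morphisms, `S_g S_h = 0` for
non-composable ones, and each `S_a` (`a ∈ G₀`) is unital and nonzero with identity `one a`
acting as claimed. The component at a morphism `g : a ⟶ b` (in Mathlib's arrow direction) is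
`comp g`, and products follow the paper's convention `S_g S_h ⊆ S_{gh}` where `gh` denotes
`h ≫ g`. -/
structure ObjectUnitalGrading (G : Type*) [Category G] (S : Type*) [NonUnitalRing S] where
  comp : ∀ {a b : G}, (a ⟶ b) → AddSubgroup S
  indep : iSupIndep fun p : Σ a : G, Σ b : G, a ⟶ b => comp p.2.2
  span : (⨆ p : Σ a : G, Σ b : G, a ⟶ b, comp p.2.2) = ⊤
  mul_mem : ∀ {a b c : G} (g : b ⟶ c) (h : a ⟶ b) {x y : S},
    x ∈ comp g → y ∈ comp h → x * y ∈ comp (h ≫ g)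
  mul_eq_zero : ∀ {a b a' b' : G} (g : a ⟶ b) (h : a' ⟶ b') {x y : S},
    x ∈ comp g → y ∈ comp h → b' ≠ a → x * y = 0
  one : G → S
  one_mem : ∀ a : G, one a ∈ comp (𝟙 a)
  one_ne_zero : ∀ a : G, one a ≠ 0
  one_mul_mem : ∀ {a b : G} (g : a ⟶ b), ∀ x ∈ comp g, one b * x = x
  mul_one_mem : ∀ {a b : G} (g : a ⟶ b), ∀ x ∈ comp g, x * one a = x

namespace ObjectUnitalGrading

variable {G : Type*} [Category G] {S : Type*} [NonUnitalRing S]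

/-- `E.hom a b = S_{G(b,a)}`, the sum of the components of all morphisms `a ⟶ b`. -/
def hom (E : ObjectUnitalGrading G S) (a b : G) : AddSubgroup S :=
  ⨆ g : a ⟶ b, E.comp g

/-- The grading is strong: `S_g S_h = S_{gh}` for all composable `g, h`. -/
def IsStronglyGraded (E : ObjectUnitalGrading G S) : Prop :=
  ∀ {a b c : G} (g : b ⟶ c) (h : a ⟶ b), sMul (E.comp g) (E.comp h) = E.comp (h ≫ g)

/-- The grading is hom-set strong: for all objects `p q`, whenever one of `S_{G(p,q)}`
and `S_{G(q,p)}` is nonzero, the other is nonzero and `1_{S_p} ∈ S_{G(p,q)} S_{G(q,p)}`. -/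
def IsHomSetStronglyGraded (E : ObjectUnitalGrading G S) : Prop :=
  ∀ p q : G, (E.hom q p ≠ ⊥ ∨ E.hom p q ≠ ⊥) →
    E.hom q p ≠ ⊥ ∧ E.hom p q ≠ ⊥ ∧ E.one p ∈ sMul (E.hom q p) (E.hom p q)

end ObjectUnitalGrading

/-- A group `H` is polycyclic-by-finite if it has a finite length subnormal series with
each factor a finite group or an infinite cyclic group. -/
def IsPolycyclicByFinite (H : Type*) [Group H] : Prop :=
  ∃ (n : ℕ) (c : Fin (n + 1) → Subgroup H),
    c 0 = ⊥ ∧ c (Fin.last n) = ⊤ ∧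
      ∀ i : Fin n,
        c i.castSucc ≤ c i.succ ∧
        ∃ _ : ((c i.castSucc).subgroupOf (c i.succ)).Normal,
          Finite ((c i.succ) ⧸ (c i.castSucc).subgroupOf (c i.succ)) ∨
            (Infinite ((c i.succ) ⧸ (c i.castSucc).subgroupOf (c i.succ)) ∧
              IsCyclic ((c i.succ) ⧸ (c i.castSucc).subgroupOf (c i.succ)))

/-- Data exhibiting the non-unital ring `A` as the category algebra `T[G]`: an additive
isomorphism with the free `T`-module on the set of morphisms of `G`, matching the
multiplication `(t g)(u h) = (t u)(gh)` for composable `g, h` (where `gh = h ≫ g`) and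
`(t g)(u h) = 0` otherwise. -/
structure CategoryAlgebraIso (T : Type*) [Ring T] (G : Type*) [Category G]
    (A : Type*) [NonUnitalRing A] where
  equiv : ((Σ a : G, Σ b : G, a ⟶ b) →₀ T) ≃+ A
  mul_single_comp : ∀ {a b c : G} (g : b ⟶ c) (h : a ⟶ b) (t u : T),
    equiv (Finsupp.single ⟨b, c, g⟩ t) * equiv (Finsupp.single ⟨a, b, h⟩ u) =
      equiv (Finsupp.single ⟨a, c, h ≫ g⟩ (t * u))
  mul_single_ne : ∀ {a b a' b' : G} (g : a ⟶ b) (h : a' ⟶ b') (t u : T), b' ≠ a →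
    equiv (Finsupp.single ⟨a, b, g⟩ t) * equiv (Finsupp.single ⟨a', b', h⟩ u) = 0

/-- Data exhibiting the non-unital ring `A` as the skew category algebra `R *_α G`: an
additive isomorphism with the direct sum `⊕_{g ∈ G₁} R_{c(g)}`, matching the multiplication
`(r g)(r' h) = (r · α_g(r')) (gh)` for composable `g, h` (where `gh = h ≫ g`) and
`(r g)(r' h) = 0` otherwise. -/
structure SkewCategoryAlgebraIso (G : Type*) [Category G]
    [DecidableEq (Σ a : G, Σ b : G, a ⟶ b)]
    (R : G → Type*) [∀ a, Ring (R a)]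
    (α : ∀ ⦃a b : G⦄, (a ⟶ b) → (R a →+* R b))
    (A : Type*) [NonUnitalRing A] where
  equiv : (Π₀ p : Σ a : G, Σ b : G, a ⟶ b, R p.2.1) ≃+ A
  mul_single_comp : ∀ {a b c : G} (g : b ⟶ c) (h : a ⟶ b) (r : R c) (r' : R b),
    equiv (DFinsupp.single ⟨b, c, g⟩ r) * equiv (DFinsupp.single ⟨a, b, h⟩ r') =
      equiv (DFinsupp.single ⟨a, c, h ≫ g⟩ (r * α g r'))
  mul_single_ne : ∀ {a b a' b' : G} (g : a ⟶ b) (h : a' ⟶ b') (r : R b) (r' : R b'),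
    b' ≠ a →
      equiv (DFinsupp.single ⟨a, b, g⟩ r) * equiv (DFinsupp.single ⟨a', b', h⟩ r') = 0


section DescendingChains

variable {S : Type*} [NonUnitalRing S]

/-- Under the descending chain condition, every nonempty subcollection has a minimal element. -/
theorem DCCOn.exists_minimal {P Q : AddSubgroup S → Prop} (h : DCCOn P)
    (hne : ∃ I, P I ∧ Q I) :
    ∃ I, P I ∧ Q I ∧ ∀ J, P J → Q J → J ≤ I → J = I := by
  by_contra! hcon
  obtain ⟨I₀, hP₀, hQ₀⟩ := hne
  have hstep : ∀ I : {I // P I ∧ Q I}, ∃ J : {I // P I ∧ Q I}, J.1 ≤ I.1 ∧ J.1 ≠ I.1 := by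
    rintro ⟨I, hP, hQ⟩
    obtain ⟨J, hJP, hJQ, hle, hne⟩ := hcon I hP hQ
    exact ⟨⟨J, hJP, hJQ⟩, hle, hne⟩
  choose next hle hne using hstep
  let f : ℕ → {I // P I ∧ Q I} := fun n => next^[n] ⟨I₀, hP₀, hQ₀⟩
  have hf : ∀ n, f (n + 1) = next (f n) := fun n => Function.iterate_succ_apply' _ _ _
  obtain ⟨n, hn⟩ := h (fun n => (f n).1) (fun n => (f n).2.1) (fun n => by
    simp only [hf]; exact hle _)
  have := hn (n + 1) (Nat.le_succ n)
  simp only [hf] at this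
  exact hne _ this

theorem DCCOn.congr {S' : Type*} [NonUnitalRing S'] (φ : AddSubgroup S ≃o AddSubgroup S')
    {P : AddSubgroup S → Prop} {Q : AddSubgroup S' → Prop} (h : ∀ I, P I ↔ Q (φ I)) :
    DCCOn P ↔ DCCOn Q := by
  constructor
  · intro hP f hf hle
    obtain ⟨n, hn⟩ := hP (fun n => φ.symm (f n)) (fun n => by rw [h]; simpa using hf n)
      (fun n => φ.symm.monotone (hle n))
    exact ⟨n, fun m hm => φ.symm.injective (hn m hm)⟩
  · intro hQ f hf hle
    obtain ⟨n, hn⟩ := hQ (fun n => φ (f n)) (fun n => (h _).1 (hf n))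
      (fun n => φ.monotone (hle n))
    exact ⟨n, fun m hm => φ.injective (hn m hm)⟩

theorem map_mem_of_mem_sMul {M : Type*} [AddGroup M] {A B : AddSubgroup S} {x : S}
    (hx : x ∈ sMul A B) (f : S →+ M) {Q : AddSubgroup M}
    (h : ∀ a ∈ A, ∀ b ∈ B, f (a * b) ∈ Q) : f x ∈ Q := by
  have : sMul A B ≤ Q.comap f := by
    refine (AddSubgroup.closure_le _).2 ?_
    rintro _ ⟨a, ha, b, hb, rfl⟩
    exact h a ha b hb
  exact this hx

end DescendingChains

namespace ObjectUnitalGrading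

section Category

variable {G : Type*} [Category G] {S : Type*} [NonUnitalRing S] (E : ObjectUnitalGrading G S)

theorem comp_induction {C : S → Prop} (hcomp : ∀ {a b : G} (g : a ⟶ b), ∀ x ∈ E.comp g, C x)
    (hzero : C 0) (hadd : ∀ x y, C x → C y → C (x + y)) (x : S) : C x := by
  have hx : x ∈ ⨆ p : Σ a : G, Σ b : G, a ⟶ b, E.comp p.2.2 := by
    rw [E.span]; trivial
  exact AddSubgroup.iSup_induction (C := C) _ hx (fun p x hx => hcomp p.2.2 x hx) hzero hadd

theorem exists_proj :
    ∃ π : (Σ a : G, Σ b : G, a ⟶ b) → S →+ S,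
      (∀ p x, π p x ∈ E.comp p.2.2) ∧
      (∀ p, ∀ x ∈ E.comp p.2.2, π p x = x) ∧
      (∀ p q, q ≠ p → ∀ x ∈ E.comp p.2.2, π q x = 0) ∧
      (∀ x, {p | π p x ≠ 0}.Finite) ∧
      (∀ x, (∀ p, π p x = 0) → x = 0) := by
  classical
  let A : (Σ a : G, Σ b : G, a ⟶ b) → AddSubgroup S := fun p => E.comp p.2.2
  have hinj := E.indep.dfinsuppSumAddHom_injective
  have hsurj : Function.Surjective
      (DFinsupp.sumAddHom fun p : Σ a : G, Σ b : G, a ⟶ b => (A p).subtype) := by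
    intro x
    refine E.comp_induction (C := fun x => ∃ y, DFinsupp.sumAddHom (fun p => (A p).subtype) y = x)
      ?_ ⟨0, map_zero _⟩ ?_ x
    · intro a b g x hx
      exact ⟨DFinsupp.single ⟨a, b, g⟩ ⟨x, hx⟩, by simp⟩
    · rintro _ _ ⟨y, rfl⟩ ⟨z, rfl⟩
      exact ⟨y + z, map_add _ _ _⟩
  let e := AddEquiv.ofBijective _ ⟨hinj, hsurj⟩
  have hsingle : ∀ p (x : A p), e.symm x = DFinsupp.single p x := by
    intro p x
    rw [AddEquiv.symm_apply_eq]
    exact (DFinsupp.sumAddHom_single (fun p => (A p).subtype) p x).symm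
  refine ⟨fun p => (A p).subtype.comp
    ((DFinsupp.evalAddMonoidHom p).comp e.symm.toAddMonoidHom), ?_, ?_, ?_, ?_, ?_⟩
  · intro p x
    exact SetLike.coe_mem _
  · intro p x hx
    change (e.symm x p : S) = x
    rw [hsingle p ⟨x, hx⟩, DFinsupp.single_eq_same]
  · intro p q hqp x hx
    change (e.symm x q : S) = 0
    rw [hsingle p ⟨x, hx⟩, DFinsupp.single_eq_of_ne hqp, ZeroMemClass.coe_zero]
  · intro x
    refine (DFinsupp.finite_support (e.symm x)).subset ?_
    intro p hp h
    refine hp ?_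
    change (e.symm x p : S) = 0
    rw [h, ZeroMemClass.coe_zero]
  · intro x hx
    have : e.symm x = 0 := by
      ext p
      exact hx p
    simpa using this

/-- The projection of `S` onto the component at the morphism `p`. -/
noncomputable def proj (p : Σ a : G, Σ b : G, a ⟶ b) : S →+ S := E.exists_proj.choose p

theorem proj_mem (p : Σ a : G, Σ b : G, a ⟶ b) (x : S) : E.proj p x ∈ E.comp p.2.2 :=
  E.exists_proj.choose_spec.1 p x

theorem proj_of_mem {a b : G} {g : a ⟶ b} {x : S} (hx : x ∈ E.comp g) :
    E.proj ⟨a, b, g⟩ x = x :=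
  E.exists_proj.choose_spec.2.1 ⟨a, b, g⟩ x hx

theorem proj_of_mem_of_ne {a b : G} {g : a ⟶ b} {q : Σ a : G, Σ b : G, a ⟶ b} {x : S}
    (hx : x ∈ E.comp g) (hq : q ≠ ⟨a, b, g⟩) : E.proj q x = 0 :=
  E.exists_proj.choose_spec.2.2.1 ⟨a, b, g⟩ q hq x hx

theorem finite_proj_ne_zero (x : S) : {p | E.proj p x ≠ 0}.Finite :=
  E.exists_proj.choose_spec.2.2.2.1 x

theorem eq_zero_of_proj {x : S} (hx : ∀ p, E.proj p x = 0) : x = 0 :=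
  E.exists_proj.choose_spec.2.2.2.2 x hx

theorem one_mul_one (a : G) : E.one a * E.one a = E.one a :=
  E.one_mul_mem _ _ (E.one_mem a)

theorem one_mul_one_of_ne {a b : G} (h : a ≠ b) : E.one a * E.one b = 0 :=
  E.mul_eq_zero _ _ (E.one_mem a) (E.one_mem b) h.symm

theorem mul_one_of_ne {a b c : G} (g : a ⟶ b) {x : S} (hx : x ∈ E.comp g) (h : c ≠ a) :
    x * E.one c = 0 :=
  E.mul_eq_zero _ _ hx (E.one_mem c) h

theorem one_mul_of_ne {a b c : G} (g : a ⟶ b) {x : S} (hx : x ∈ E.comp g) (h : c ≠ b) :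
    E.one c * x = 0 :=
  E.mul_eq_zero _ _ (E.one_mem c) hx h.symm

theorem sum_one_mul [Fintype G] (x : S) : ∑ b, E.one b * x = x := by
  refine E.comp_induction (C := fun x => ∑ b, E.one b * x = x) ?_ (by simp) ?_ x
  · intro a b g x hx
    rw [Finset.sum_eq_single b (fun c _ hc => E.one_mul_of_ne g hx hc) (by simp)]
    exact E.one_mul_mem g x hx
  · intro x y hx hy
    simp only [mul_add, Finset.sum_add_distrib, hx, hy]

theorem sum_mul_one [Fintype G] (x : S) : ∑ b, x * E.one b = x := by
  refine E.comp_induction (C := fun x => ∑ b, x * E.one b = x) ?_ (by simp) ?_ x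
  · intro a b g x hx
    rw [Finset.sum_eq_single a (fun c _ hc => E.mul_one_of_ne g hx hc) (by simp)]
    exact E.mul_one_mem g x hx
  · intro x y hx hy
    simp only [add_mul, Finset.sum_add_distrib, hx, hy]

theorem one_mul_mul_one_mem_hom (a b : G) (x : S) : E.one b * x * E.one a ∈ E.hom a b := by
  refine E.comp_induction (C := fun x => E.one b * x * E.one a ∈ E.hom a b) ?_ (by simp) ?_ x
  · intro c d g x hx
    by_cases hd : b = d
    · subst hd
      rw [E.one_mul_mem g x hx]
      by_cases hc : a = c
      · subst hc
        rw [E.mul_one_mem g x hx]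
        exact le_iSup (fun g : a ⟶ b => E.comp g) g hx
      · rw [E.mul_one_of_ne g hx hc]
        exact zero_mem _
    · rw [E.one_mul_of_ne g hx hd, zero_mul]
      exact zero_mem _
  · intro x y hx hy
    rw [mul_add, add_mul]
    exact add_mem hx hy

theorem finite_of_isLeftArtinian (E : ObjectUnitalGrading G S) (h : IsLeftArtinian S) :
    Finite G := by
  by_contra hG
  rw [not_finite_iff_infinite] at hG
  let a : ℕ ↪ G := Infinite.natEmbedding G
  let I : ℕ → AddSubgroup S := fun n =>
    ⨅ i ∈ Finset.range n, (AddMonoidHom.mulRight (E.one (a i))).ker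
  have hI : ∀ n x, x ∈ I n ↔ ∀ i < n, x * E.one (a i) = 0 := by
    intro n x
    simp [I, AddSubgroup.mem_iInf, AddMonoidHom.mem_ker]
  obtain ⟨n, hn⟩ := h I
    (fun n => ⟨le_top, fun s _ x hx => by
      rw [hI] at hx ⊢
      intro i hi
      rw [mul_assoc, hx i hi, mul_zero]⟩)
    (fun n x hx => by
      rw [hI] at hx ⊢
      exact fun i hi => hx i (by omega))
  have hmem : E.one (a n) ∈ I n := by
    rw [hI]
    intro i hi
    exact E.one_mul_one_of_ne (fun h => by have := a.injective h; omega)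
  rw [← hn (n + 1) (Nat.le_succ n), hI] at hmem
  have := hmem n (Nat.lt_succ_self n)
  rw [E.one_mul_one] at this
  exact E.one_ne_zero _ this

end Category

section Groupoid

variable {G : Type*} [Groupoid G] {S : Type*} [NonUnitalRing S] (E : ObjectUnitalGrading G S)

theorem proj_comp_mul {a b c : G} (k : a ⟶ b) (p : b ⟶ c) {z : S} (hz : z ∈ E.comp k) (x : S) :
    E.proj ⟨a, c, k ≫ p⟩ (x * z) = E.proj ⟨b, c, p⟩ x * z := by
  refine E.comp_induction
    (C := fun x => E.proj ⟨a, c, k ≫ p⟩ (x * z) = E.proj ⟨b, c, p⟩ x * z) ?_ (by simp) ?_ x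
  · intro d e q x hx
    by_cases hd : b = d
    · subst hd
      by_cases he : c = e
      · subst he
        by_cases hpq : p = q
        · subst hpq
          rw [E.proj_of_mem hx, E.proj_of_mem (E.mul_mem p k hx hz)]
        · rw [E.proj_of_mem_of_ne hx (by simpa using hpq),
            E.proj_of_mem_of_ne (E.mul_mem q k hx hz) (by simpa [cancel_epi] using hpq), zero_mul]
      · rw [E.proj_of_mem_of_ne hx (fun h => he (congrArg (fun p => p.2.1) h)),
            E.proj_of_mem_of_ne (E.mul_mem q k hx hz) (fun h => he (congrArg (fun p => p.2.1) h)),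
            zero_mul]
    · rw [E.mul_eq_zero q k hx hz hd, map_zero,
        E.proj_of_mem_of_ne hx (fun h => hd (congrArg (fun p => p.1) h)), zero_mul]
  · intro x y hx hy
    rw [add_mul, map_add, map_add, add_mul, hx, hy]

theorem proj_mul_comp {a b c : G} (k : b ⟶ c) (p : a ⟶ b) {z : S} (hz : z ∈ E.comp k) (x : S) :
    E.proj ⟨a, c, p ≫ k⟩ (z * x) = z * E.proj ⟨a, b, p⟩ x := by
  refine E.comp_induction
    (C := fun x => E.proj ⟨a, c, p ≫ k⟩ (z * x) = z * E.proj ⟨a, b, p⟩ x) ?_ (by simp) ?_ x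
  · intro d e q x hx
    by_cases hd : e = b
    · subst hd
      by_cases he : a = d
      · subst he
        by_cases hpq : p = q
        · subst hpq
          rw [E.proj_of_mem hx, E.proj_of_mem (E.mul_mem k p hz hx)]
        · rw [E.proj_of_mem_of_ne hx (by simpa using hpq),
            E.proj_of_mem_of_ne (E.mul_mem k q hz hx) (by simpa [cancel_mono] using hpq), mul_zero]
      · rw [E.proj_of_mem_of_ne hx (fun h => he (congrArg (fun p => p.1) h)),
            E.proj_of_mem_of_ne (E.mul_mem k q hz hx) (fun h => he (congrArg (fun p => p.1) h)),
            mul_zero]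
    · rw [E.mul_eq_zero k q hz hx hd, map_zero,
        E.proj_of_mem_of_ne hx (fun h => hd (congrArg (fun p => p.2.1) h).symm), mul_zero]
  · intro x y hx hy
    rw [mul_add, map_add, map_add, mul_add, hx, hy]

theorem leftArtinianOn_comp_id (h : IsLeftArtinian S) (a : G) :
    LeftArtinianOn (E.comp (𝟙 a)) := by
  intro I hI hle
  let J : ℕ → AddSubgroup S := fun n =>
    ⨅ s : S, (I n).comap ((E.proj ⟨a, a, 𝟙 a⟩).comp (AddMonoidHom.mulLeft s))
  have hJ : ∀ n x, x ∈ J n ↔ ∀ s, E.proj ⟨a, a, 𝟙 a⟩ (s * x) ∈ I n := by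
    intro n x
    simp [J, AddSubgroup.mem_iInf]
  have hIJ : ∀ n, ∀ x ∈ E.comp (𝟙 a), x ∈ J n ↔ x ∈ I n := by
    intro n x hx
    rw [hJ]
    constructor
    · intro h
      have := h (E.one a)
      rwa [E.one_mul_mem _ x hx, E.proj_of_mem hx] at this
    · intro h s
      have := E.proj_comp_mul (𝟙 a) (𝟙 a) hx s
      rw [Category.comp_id] at this
      rw [this]
      exact (hI n).2 _ (E.proj_mem ⟨a, a, 𝟙 a⟩ s) x h
  obtain ⟨n, hn⟩ := h J
    (fun n => ⟨le_top, fun s _ x hx => by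
      rw [hJ] at hx ⊢
      intro t
      rw [← mul_assoc]
      exact hx _⟩)
    (fun n x hx => by
      rw [hJ] at hx ⊢
      exact fun s => hle n (hx s))
  refine ⟨n, fun m hm => ?_⟩
  ext x
  constructor
  · intro hx
    have hc := (hI m).1 hx
    rw [← hIJ n x hc, ← hn m hm, hIJ m x hc]
    exact hx
  · intro hx
    have hc := (hI n).1 hx
    rw [← hIJ m x hc, hn m hm, hIJ n x hc]
    exact hx

/-- The component at an endomorphism `g` of the object `a`. -/
def endComp {a : G} (g : End a) : AddSubgroup S := E.comp (a := a) (b := a) g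

theorem endComp_mul_mem {a : G} {g h : End a} {x y : S} (hx : x ∈ E.endComp g)
    (hy : y ∈ E.endComp h) : x * y ∈ E.endComp (g * h) :=
  E.mul_mem (a := a) (b := a) (c := a) g h hx hy

theorem one_mul_endComp {a : G} {g : End a} {x : S} (hx : x ∈ E.endComp g) :
    E.one a * x = x :=
  E.one_mul_mem _ x hx

theorem endComp_mul_one {a : G} {g : End a} {x : S} (hx : x ∈ E.endComp g) :
    x * E.one a = x :=
  E.mul_one_mem _ x hx

theorem IsStronglyGraded.one_mem_sMul {E : ObjectUnitalGrading G S} (hE : E.IsStronglyGraded)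
    {a b : G} (g : a ⟶ b) :
    E.one b ∈ sMul (E.comp g) (E.comp (Groupoid.inv g)) := by
  rw [hE, Groupoid.inv_comp]
  exact E.one_mem b

theorem IsStronglyGraded.one_mem_sMul_endComp {E : ObjectUnitalGrading G S}
    (hE : E.IsStronglyGraded) {a : G} (g : End a) :
    E.one a ∈ sMul (E.endComp g) (E.endComp g⁻¹) :=
  hE.one_mem_sMul (a := a) (b := a) g

theorem proj_mul_one_of_ne {a b c : G} (q : b ⟶ c) (h : a ≠ b) (x : S) :
    E.proj ⟨b, c, q⟩ (x * E.one a) = 0 := by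
  have := E.proj_comp_mul (𝟙 b) q (E.one_mem b) (x * E.one a)
  rw [mul_assoc, E.one_mul_one_of_ne h, mul_zero, map_zero,
    E.mul_one_mem q _ (E.proj_mem ⟨b, c, q⟩ _)] at this
  exact this.symm

theorem pow_comp_injective {a b : G} {k : End a} (hk : Function.Injective fun n : ℤ => k ^ n)
    (p : a ⟶ b) :
    Function.Injective fun n : ℤ =>
      (⟨a, b, (show a ⟶ a from k ^ n) ≫ p⟩ : Σ a : G, Σ b : G, a ⟶ b) := by
  intro m n h
  apply hk
  simpa [cancel_mono] using h

theorem proj_zpow_succ {a b : G} (k : End a) (p : a ⟶ b) {y z : S} (hz : z ∈ E.endComp k)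
    (hy : y * E.one a = y) (n : ℤ) :
    E.proj ⟨a, b, (show a ⟶ a from k ^ (n + 1)) ≫ p⟩ (y * E.one a + y * z) =
      E.proj ⟨a, b, (show a ⟶ a from k ^ (n + 1)) ≫ p⟩ y +
        E.proj ⟨a, b, (show a ⟶ a from k ^ n) ≫ p⟩ y * z := by
  have hpow : (show a ⟶ a from k ^ (n + 1)) ≫ p =
      (show a ⟶ a from k) ≫ (show a ⟶ a from k ^ n) ≫ p := by
    rw [zpow_add_one, End.mul_def, Category.assoc]
  rw [hy, map_add]
  congr 1
  rw [hpow]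
  exact E.proj_comp_mul (a := a) (b := a) k _ hz y

theorem eq_zero_of_mul_one_add_mul_eq_zero {a : G} {k : End a}
    (hk : Function.Injective fun n : ℤ => k ^ n) {y z : S} (hz : z ∈ E.endComp k)
    (hy : y * E.one a = y) (h : y * E.one a + y * z = 0) : y = 0 := by
  refine E.eq_zero_of_proj ?_
  rintro ⟨c, b, p⟩
  by_cases hc : a = c
  · subst hc
    let f : ℤ → S := fun n => E.proj ⟨a, b, (show a ⟶ a from k ^ n) ≫ p⟩ y
    have hf : ∀ n, f (n + 1) = -(f n * z) := by
      intro n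
      have := E.proj_zpow_succ k p hz hy n
      rw [h, map_zero] at this
      exact eq_neg_of_add_eq_zero_left this.symm
    have hfin : {n | f n ≠ 0}.Finite :=
      (E.finite_proj_ne_zero y).preimage (pow_comp_injective hk p).injOn
    obtain ⟨N, hN⟩ := hfin.bddBelow
    have hzero : ∀ n : ℕ, f (N - 1 + n) = 0 := by
      intro n
      induction n with
      | zero =>
        by_contra hne
        have := hN hne
        simp at this
      | succ n ih =>
        have := hf (N - 1 + n)
        rw [ih, zero_mul, neg_zero] at this
        rw [← this]
        congr 1
        push_cast
        ring
    have hall : f 0 = 0 := by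
      by_contra hne
      have h0 : N ≤ 0 := hN hne
      have := hzero (1 - N).toNat
      rw [Int.toNat_of_nonneg (by omega)] at this
      exact hne (by simpa using this)
    have hid : (show a ⟶ a from k ^ (0 : ℤ)) ≫ p = p := by
      rw [zpow_zero]
      exact Category.id_comp p
    have : E.proj ⟨a, b, (show a ⟶ a from k ^ (0 : ℤ)) ≫ p⟩ y = 0 := hall
    rwa [hid] at this
  · rw [← hy]
    exact E.proj_mul_one_of_ne p hc y

/-- Over a left artinian ring, right multiplication by a homogeneous element whose degree has
infinite order is locally nilpotent on the component of the identity. -/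
theorem exists_iterate_mul_eq_zero (h : IsLeftArtinian S) {a : G} {k : End a}
    (hk : Function.Injective fun n : ℤ => k ^ n) {u z : S} (hz : z ∈ E.endComp k)
    (hu : u ∈ E.endComp (1 : End a)) : ∃ n : ℕ, (fun x => x * z)^[n] u = 0 := by
  let ρ : AddMonoid.End S := AddMonoidHom.mulRight (E.one a) + AddMonoidHom.mulRight z
  have hρ : ∀ x, ρ x = x * E.one a + x * z := fun x => rfl
  have hρone : ∀ x, ρ x * E.one a = ρ x := by
    intro x
    rw [hρ, add_mul, mul_assoc, mul_assoc, E.one_mul_one, E.endComp_mul_one hz]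
  have hρmul : ∀ x, ρ (x * E.one a) = ρ x := by
    intro x
    rw [hρ, hρ, mul_assoc, mul_assoc, E.one_mul_one, E.one_mul_endComp hz]
  have hpow : ∀ (n : ℕ) (x : S), (ρ ^ (n + 1)) x = (ρ ^ n) (ρ x) := by
    intro n x
    rw [pow_succ]
    rfl
  have hlin : ∀ (n : ℕ) (s x : S), s * (ρ ^ n) x = (ρ ^ n) (s * x) := by
    intro n s
    induction n with
    | zero => intro x; rfl
    | succ n ih =>
      intro x
      rw [hpow, hpow, ih, hρ, hρ, mul_add,
        mul_assoc, mul_assoc]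
  have hker : ∀ (n : ℕ) (x : S), x * E.one a = x → (ρ ^ n) x = 0 → x = 0 := by
    intro n
    induction n with
    | zero => intro x _ hx; exact hx
    | succ n ih =>
      intro x hxe hx
      rw [hpow] at hx
      exact E.eq_zero_of_mul_one_add_mul_eq_zero hk hz hxe (ih (ρ x) (hρone x) hx)
  obtain ⟨n, hn⟩ := h (fun n => AddMonoidHom.range (ρ ^ n : AddMonoid.End S))
    (fun n => ⟨le_top, by
      rintro s _ _ ⟨x, rfl⟩
      exact ⟨s * x, (hlin n s x).symm⟩⟩)
    (fun n => by
      rintro _ ⟨x, rfl⟩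
      exact ⟨ρ x, (hpow n x).symm⟩)
  have hun : (ρ ^ n) u ∈ AddMonoidHom.range (ρ ^ n : AddMonoid.End S) := ⟨u, rfl⟩
  rw [← hn (n + 1) (Nat.le_succ n)] at hun
  obtain ⟨y', hy'⟩ := hun
  have hue : u * E.one a = u := E.endComp_mul_one hu
  obtain ⟨y, hye, hy⟩ : ∃ y, y * E.one a = y ∧ y * E.one a + y * z = u := by
    refine ⟨y' * E.one a, by rw [mul_assoc, E.one_mul_one], ?_⟩
    rw [← hρ, hρmul, ← sub_eq_zero]
    refine hker n _ (by rw [sub_mul, hρone, hue]) ?_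
    rw [map_sub, sub_eq_zero]
    exact (hpow n y').symm.trans hy'
  let f : ℤ → S := fun n => E.proj ⟨a, a, (show a ⟶ a from k ^ n) ≫ 𝟙 a⟩ y
  have hstep : ∀ n, f (n + 1) =
      E.proj ⟨a, a, (show a ⟶ a from k ^ (n + 1)) ≫ 𝟙 a⟩ u - f n * z := by
    intro n
    rw [← hy, E.proj_zpow_succ k (𝟙 a) hz hye n, add_sub_cancel_right]
  have hstep_ne : ∀ n, n + 1 ≠ 0 → f (n + 1) = -(f n * z) := by
    intro n hne
    rw [hstep, E.proj_of_mem_of_ne (g := 𝟙 a) hu, zero_sub]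
    intro heq
    refine hne (pow_comp_injective hk (𝟙 a) ?_)
    simp only [heq, zpow_zero]
    simp [End.one_def]
  have hfin : {n | f n ≠ 0}.Finite :=
    (E.finite_proj_ne_zero y).preimage (pow_comp_injective hk (𝟙 a)).injOn
  have hneg : f (-1) = 0 := by
    obtain ⟨N, hN⟩ := hfin.bddBelow
    have hzero : ∀ n : ℕ, N - 1 + n < 0 → f (N - 1 + n) = 0 := by
      intro n
      induction n with
      | zero =>
        intro _
        by_contra hne
        have := hN hne
        simp at this
      | succ n ih =>
        intro hlt
        push_cast at hlt ⊢
        rw [← add_assoc, hstep_ne _ (by omega), ih (by omega), zero_mul, neg_zero]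
    by_contra hne
    have h0 : N ≤ -1 := hN hne
    have := hzero (-N).toNat
    rw [Int.toNat_of_nonneg (by omega)] at this
    have heq : N - 1 + -N = -1 := by ring
    rw [heq] at this
    exact hne (this (by omega))
  have hzero : f 0 = u := by
    have := hstep (-1)
    rw [hneg, zero_mul, sub_zero] at this
    have hid : (show a ⟶ a from k ^ (-1 + 1 : ℤ)) ≫ 𝟙 a = 𝟙 a := by
      simp [End.one_def]
    rw [hid, E.proj_of_mem (g := 𝟙 a) hu] at this
    exact this
  have hiter : ∀ n : ℕ, f n = (fun x => x * z)^[n] u ∨ f n = -(fun x => x * z)^[n] u := by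
    intro n
    induction n with
    | zero => exact Or.inl hzero
    | succ n ih =>
      rw [Nat.cast_succ, hstep_ne _ (by omega), Function.iterate_succ_apply']
      rcases ih with ih | ih <;> rw [ih]
      · exact Or.inr rfl
      · exact Or.inl (by rw [neg_mul, neg_neg])
  obtain ⟨N, hN⟩ := hfin.bddAbove
  refine ⟨(N + 1).toNat, ?_⟩
  have hf : f ((N + 1).toNat : ℤ) = 0 := by
    by_contra hne
    have := hN hne
    omega
  rcases hiter (N + 1).toNat with h | h
  · rw [← h, hf]
  · rwa [hf, eq_comm, neg_eq_zero] at h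

theorem exists_prime_subgroup (h : IsLeftArtinian S) (a : G) :
    ∃ P : AddSubgroup S, E.one a ∉ P ∧ (∀ x ∈ P, ∀ s, s * x ∈ P) ∧ (∀ x ∈ P, ∀ s, x * s ∈ P) ∧
      ∀ x ∈ E.endComp (1 : End a), ∀ y ∈ E.endComp (1 : End a),
        (∀ g : End a, ∀ s ∈ E.endComp g, x * s * y ∈ P) → x ∈ P ∨ y ∈ P := by
  obtain ⟨N, hN, ⟨n₀, hn₀, hne₀⟩, hmin⟩ := h.exists_minimal
    (Q := fun I => ∃ x ∈ I, E.one a * x ≠ 0)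
    ⟨⊤, ⟨le_rfl, fun _ _ _ _ => trivial⟩, E.one a, trivial, by
      rw [E.one_mul_one]; exact E.one_ne_zero a⟩
  have hsimple : ∀ y ∈ N, E.one a * y ≠ 0 → ∀ n ∈ N, ∃ s, s * y = n := by
    intro y hy hne n hn
    have hJ : (AddMonoidHom.mulRight y).range = N := by
      refine hmin _ ⟨le_top, ?_⟩ ⟨E.one a * y, ⟨_, rfl⟩, ?_⟩ ?_
      · rintro s _ _ ⟨t, rfl⟩
        exact ⟨s * t, mul_assoc _ _ _⟩
      · rwa [← mul_assoc, E.one_mul_one]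
      · rintro _ ⟨t, rfl⟩
        exact hN.2 t trivial y hy
    rw [← hJ] at hn
    exact hn
  let P : AddSubgroup S := ⨅ n ∈ N, (AddMonoidHom.mulRight n).ker
  have hP : ∀ x, x ∈ P ↔ ∀ n ∈ N, x * n = 0 := by
    intro x
    simp [P, AddSubgroup.mem_iInf, AddMonoidHom.mem_ker]
  refine ⟨P, ?_, ?_, ?_, ?_⟩
  · rw [hP]
    exact fun h => hne₀ (h n₀ hn₀)
  · intro x hx s
    rw [hP] at hx ⊢
    intro n hn
    rw [mul_assoc, hx n hn, mul_zero]
  · intro x hx s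
    rw [hP] at hx ⊢
    intro n hn
    rw [mul_assoc]
    exact hx _ (hN.2 s trivial n hn)
  · intro x hx y hy hxy
    rw [or_iff_not_imp_right, hP y, hP x]
    intro hyP
    push Not at hyP
    obtain ⟨n, hn, hyn⟩ := hyP
    intro n' hn'
    obtain ⟨s, rfl⟩ := hsimple (y * n) (hN.2 y trivial n hn)
      (by rwa [← mul_assoc, E.one_mul_endComp hy]) n' hn'
    rw [← mul_assoc, ← mul_assoc]
    refine E.comp_induction (C := fun s => x * s * y * n = 0) ?_ (by simp) ?_ s
    · intro c d q s hs
      by_cases hd : d = a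
      · subst hd
        by_cases hc : d = c
        · subst hc
          exact (hP _).1 (hxy q s hs) n hn
        · rw [mul_assoc x, E.mul_eq_zero q (𝟙 d) hs hy hc, mul_zero, zero_mul]
      · rw [E.mul_eq_zero (𝟙 a) q hx hs hd, zero_mul, zero_mul]
    · intro s t hs ht
      rw [mul_add, add_mul, add_mul, hs, ht, add_zero]

/-- If `S` is left artinian and `k₀` has infinite order, some homogeneous element whose degree
is a nontrivial endomorphism is not nilpotent. -/
theorem exists_iterate_mul_ne_zero {E : ObjectUnitalGrading G S} (hE : E.IsStronglyGraded)
    (h : IsLeftArtinian S) {a : G} {k₀ : End a}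
    (hk₀ : Function.Injective fun n : ℕ => k₀ ^ n) :
    ∃ k : End a, k ≠ 1 ∧ ∃ z ∈ E.endComp k, ∃ u ∈ E.endComp (1 : End a),
      ∀ n : ℕ, (fun x => x * z)^[n] u ≠ 0 := by
  obtain ⟨P, hone, hPl, hPr, hprime⟩ := E.exists_prime_subgroup h a
  have hart : LeftArtinianOn (E.endComp (1 : End a)) := E.leftArtinianOn_comp_id h a
  have hmul : ∀ {g h l : End a} {x y : S}, x ∈ E.endComp g → y ∈ E.endComp h → g * h = l →
      x * y ∈ E.endComp l := by
    rintro g h _ x y hx hy rfl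
    exact E.endComp_mul_mem hx hy
  obtain ⟨L, hL, ⟨l₀, hl₀, hl₀P⟩, hmin⟩ := hart.exists_minimal (Q := fun I => ∃ x ∈ I, x ∉ P)
    ⟨E.endComp (1 : End a),
      ⟨le_rfl, fun s hs x hx => hmul hs hx (mul_one 1)⟩,
      E.one a, E.one_mem a, hone⟩
  obtain ⟨k, hk, u, hu, t, ht, v, hv, hutv⟩ : ∃ k : End a, k ≠ 1 ∧ ∃ u ∈ L, ∃ t ∈ E.endComp k,
      ∃ v ∈ L, u * t * v ∉ P := by
    by_contra! hcon
    let K : ℕ → AddSubgroup S := fun n => E.endComp (1 : End a) ⊓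
      ⨅ i ∈ Finset.range n, ⨅ t ∈ E.endComp (k₀ ^ i), ⨅ l ∈ L,
        P.comap ((AddMonoidHom.mulRight l).comp (AddMonoidHom.mulRight t))
    have hK : ∀ n x, x ∈ K n ↔ x ∈ E.endComp (1 : End a) ∧
        ∀ i < n, ∀ t ∈ E.endComp (k₀ ^ i), ∀ l ∈ L, x * t * l ∈ P := by
      intro n x
      simp [K, AddSubgroup.mem_iInf]
    obtain ⟨n, hn⟩ := hart K
      (fun n => ⟨fun x hx => ((hK n x).1 hx).1, fun s hs x hx => by
        rw [hK] at hx ⊢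
        refine ⟨hmul hs hx.1 (mul_one 1), fun i hi t ht l hl => ?_⟩
        rw [mul_assoc s, mul_assoc s]
        exact hPl _ (hx.2 i hi t ht l hl) s⟩)
      (fun n x hx => by
        rw [hK] at hx ⊢
        exact ⟨hx.1, fun i hi => hx.2 i (by omega)⟩)
    have hmem : ∀ t ∈ E.endComp (k₀ ^ n), ∀ l ∈ L, ∀ s ∈ E.endComp (k₀ ^ n)⁻¹,
        t * l * s ∈ K n := by
      intro t ht l hl s hs
      rw [hK]
      refine ⟨hmul (hmul ht (hL.1 hl) (mul_one _)) hs (mul_inv_cancel _), ?_⟩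
      intro i hi t' ht' l' hl'
      have hne : (k₀ ^ n)⁻¹ * k₀ ^ i ≠ 1 := by
        intro heq
        rw [inv_mul_eq_one] at heq
        have := hk₀ heq
        omega
      have := hPl _ (hcon _ hne l hl (s * t') (E.endComp_mul_mem hs ht') l' hl') t
      simpa only [mul_assoc] using this
    have hsq : ∀ l ∈ L, ∀ l' ∈ L, l * l' ∈ P := by
      intro l hl l' hl'
      have hinner : ∀ t ∈ E.endComp (k₀ ^ n), t * l * l' ∈ P := by
        intro t ht
        have key := map_mem_of_mem_sMul (hE.one_mem_sMul_endComp (k₀ ^ n)⁻¹)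
          ((AddMonoidHom.mulRight l').comp (AddMonoidHom.mulLeft (t * l))) (Q := P) (by
            intro s hs t' ht'
            have := hmem t ht l hl s hs
            rw [← hn (n + 1) (Nat.le_succ n), hK] at this
            rw [inv_inv] at ht'
            have := this.2 n (Nat.lt_succ_self n) t' ht' l' hl'
            simpa [mul_assoc] using this)
        simpa [mul_assoc, E.endComp_mul_one (hL.1 hl), E.one_mul_endComp (hL.1 hl')] using key
      have key := map_mem_of_mem_sMul (hE.one_mem_sMul_endComp (k₀ ^ n)⁻¹)
          (AddMonoidHom.mulRight (l * l')) (Q := P) (by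
            intro r hr t ht
            rw [inv_inv] at ht
            have := hPl _ (hinner t ht) r
            simpa [mul_assoc] using this)
      simpa [← mul_assoc, E.one_mul_endComp (hL.1 hl)] using key
    refine hl₀P ((or_self_iff).1 (hprime l₀ (hL.1 hl₀) l₀ (hL.1 hl₀) ?_))
    intro g s hs
    by_cases hg : g = 1
    · subst hg
      rw [mul_assoc]
      exact hsq _ hl₀ _ (hL.2 s hs l₀ hl₀)
    · exact hcon g hg l₀ hl₀ s hs l₀ hl₀
  have hz : t * v ∈ E.endComp k := hmul ht (hL.1 hv) (mul_one k)
  have hLz : ∀ x ∈ L, x ∉ P → x * (t * v) ∉ P := by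
    intro x hx hxP hxz
    have hN : L ⊓ P.comap (AddMonoidHom.mulRight (t * v)) = L ∨
        ∀ y ∈ L ⊓ P.comap (AddMonoidHom.mulRight (t * v)), y ∈ P := by
      by_contra! hcon
      obtain ⟨hne, hy⟩ := hcon
      refine hne (hmin _ ⟨inf_le_left.trans hL.1, ?_⟩ hy inf_le_left)
      intro s hs y hy
      refine ⟨hL.2 s hs y hy.1, ?_⟩
      have := hPl _ hy.2 s
      simpa [mul_assoc] using this
    rcases hN with hN | hN
    · have : u ∈ L ⊓ P.comap (AddMonoidHom.mulRight (t * v)) := by rwa [hN]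
      have huz : u * (t * v) ∈ P := this.2
      rw [← mul_assoc] at huz
      exact hutv huz
    · exact hxP (hN x ⟨hx, hxz⟩)
  refine ⟨k, hk, t * v, hz, u, hL.1 hu, ?_⟩
  have hiter : ∀ n : ℕ, (fun x => x * (t * v))^[n] u ∈ E.endComp (k ^ n) ∧
      (fun x => x * (t * v))^[n] u ∉ P ∧
      ∀ s ∈ E.endComp (k ^ n)⁻¹, s * (fun x => x * (t * v))^[n] u ∈ L := by
    intro n
    induction n with
    | zero =>
      refine ⟨?_, ?_, ?_⟩
      · rw [pow_zero]
        exact hL.1 hu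
      · intro huP
        exact hutv (hPr _ (hPr _ huP t) v)
      · intro s hs
        rw [pow_zero, inv_one] at hs
        exact hL.2 s hs u hu
    | succ n ih =>
      rw [Function.iterate_succ_apply']
      obtain ⟨hmem, hnP, hs⟩ := ih
      generalize (fun x => x * (t * v))^[n] u = x at hmem hnP hs
      refine ⟨hmul hmem hz (pow_succ k n).symm, ?_, ?_⟩
      · intro hxP
        apply hnP
        have key := map_mem_of_mem_sMul (hE.one_mem_sMul_endComp (k ^ n))
          (AddMonoidHom.mulRight x) (Q := P) (by
            intro r hr s hs'
            by_contra hrs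
            have hsx : s * x ∉ P := fun hsx => hrs (by
              simpa [mul_assoc] using hPl _ hsx r)
            refine hLz _ (hs s hs') hsx ?_
            rw [mul_assoc]
            exact hPl _ hxP s)
        simpa [E.one_mul_endComp hmem] using key
      · intro s hs'
        have : s * (x * t) * v ∈ L :=
          hL.2 _ (hmul hs' (E.endComp_mul_mem hmem ht) (by
            rw [← pow_succ]
            exact inv_mul_cancel _)) v hv
        simpa only [mul_assoc] using this
  intro n hn
  refine (hiter n).2.1 ?_
  rw [hn]
  exact zero_mem _

theorem end_eq_one_of_isLeftArtinian
    (htf : ∀ (a : G) (g : End a) (n : ℕ), 0 < n → g ^ n = 1 → g = 1)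
    {E : ObjectUnitalGrading G S} (hE : E.IsStronglyGraded) (h : IsLeftArtinian S)
    {a : G} (g : End a) : g = 1 := by
  have hinj : ∀ k : End a, k ≠ 1 → Function.Injective fun n : ℤ => k ^ n := by
    intro k hk
    rw [injective_zpow_iff_not_isOfFinOrder, isOfFinOrder_iff_pow_eq_one]
    rintro ⟨n, hn, hpow⟩
    exact hk (htf a k n hn hpow)
  by_contra hg
  obtain ⟨k, hk, z, hz, u, hu, hne⟩ := exists_iterate_mul_ne_zero hE h (k₀ := g) (by
    intro m n hmn
    have := hinj g hg (a₁ := m) (a₂ := n) (by simpa using hmn)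
    exact_mod_cast this)
  obtain ⟨n, hn⟩ := E.exists_iterate_mul_eq_zero h (hinj k hk) hz hu
  exact hne n hn

theorem hom_self_eq_comp_id (E : ObjectUnitalGrading G S) {a : G} (h : ∀ g : End a, g = 1) :
    E.hom a a = E.comp (𝟙 a) := by
  refine le_antisymm (iSup_le fun g => ?_) (le_iSup (fun g : a ⟶ a => E.comp g) (𝟙 a))
  rw [show g = 𝟙 a from h g]

/-- If `S_{G(a)}` is a finitely generated left `S_a`-module, the isotropy group at `a` is
finite, hence trivial if it is torsion-free. -/
theorem end_eq_one_of_isFGLeftModuleIn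
    (htf : ∀ (a : G) (g : End a) (n : ℕ), 0 < n → g ^ n = 1 → g = 1)
    {E : ObjectUnitalGrading G S} (hE : E.IsStronglyGraded) {a : G}
    (h : IsFGLeftModuleIn (E.comp (𝟙 a)) (E.hom a a)) (g : End a) : g = 1 := by
  obtain ⟨F, -, hF⟩ := h
  let D : Set (Σ a : G, Σ b : G, a ⟶ b) := ⋃ x ∈ F, {p | E.proj p x ≠ 0}
  have hD : D.Finite := F.finite_toSet.biUnion fun x _ => E.finite_proj_ne_zero x
  let M : AddSubgroup S :=
    ⨅ g : {g : End a // (⟨a, a, g⟩ : Σ a : G, Σ b : G, a ⟶ b) ∉ D}, (E.proj ⟨a, a, g.1⟩).ker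
  have hM : ∀ x, x ∈ M ↔ ∀ g : End a, (⟨a, a, g⟩ : Σ a : G, Σ b : G, a ⟶ b) ∉ D →
      E.proj ⟨a, a, g⟩ x = 0 := by
    intro x
    simp [M, AddSubgroup.mem_iInf, AddMonoidHom.mem_ker]
  have hle : ∀ x ∈ E.hom a a, x ∈ M := by
    intro x hx
    refine AddSubgroup.mem_sInf.1 (hF x hx) M ⟨?_, ?_⟩
    · intro y hy
      refine (hM y).2 fun g hg => ?_
      by_contra hne
      exact hg (Set.mem_biUnion hy hne)
    · intro s hs y hy
      rw [hM] at hy ⊢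
      intro g hg
      have := E.proj_mul_comp (𝟙 a) (show a ⟶ a from g) hs y
      rw [Category.comp_id] at this
      rw [this, hy g hg, mul_zero]
  have hmem : ∀ g : End a, (⟨a, a, g⟩ : Σ a : G, Σ b : G, a ⟶ b) ∈ D := by
    intro g
    by_contra hg
    have hzero : ∀ x ∈ E.endComp g, x = 0 := by
      intro x hx
      have := (hM x).1 (hle x (le_iSup (fun g : a ⟶ a => E.comp g) g hx)) g hg
      rwa [E.proj_of_mem (g := show a ⟶ a from g) hx] at this
    have := map_mem_of_mem_sMul (hE.one_mem_sMul_endComp g) (AddMonoidHom.id S) (Q := ⊥) (by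
      intro x hx y _
      simp [hzero x hx])
    exact E.one_ne_zero a this
  have hfin : Finite (End a) := by
    have hf : Function.Injective
        fun g : End a => (⟨⟨a, a, g⟩, hmem g⟩ : D) := by
      intro g g' h
      simpa using h
    have := hD.to_subtype
    exact Finite.of_injective _ hf
  obtain ⟨n, hn, hpow⟩ := isOfFinOrder_iff_pow_eq_one.1 (isOfFinOrder_of_finite g)
  exact htf a g n hn hpow

theorem isLeftArtinian_of_end_eq_one [Finite G] {E : ObjectUnitalGrading G S}
    (hE : E.IsStronglyGraded) (hend : ∀ (a : G) (g : End a), g = 1)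
    (h : ∀ a : G, LeftArtinianOn (E.comp (𝟙 a))) : IsLeftArtinian S := by
  classical
  have : Fintype G := Fintype.ofFinite G
  have hcol : ∀ (a : G) (I : ℕ → AddSubgroup S), (∀ n, IsLeftIdealIn ⊤ (I n)) →
      (∀ n, I (n + 1) ≤ I n) → (∀ n, ∀ x ∈ I n, x * E.one a = x) →
      ∃ n, ∀ m, n ≤ m → I m = I n := by
    intro a I hI hle hIa
    obtain ⟨n, hn⟩ := h a (fun n => I n ⊓ E.comp (𝟙 a))
      (fun n => ⟨inf_le_right, fun s hs x hx => ⟨(hI n).2 s trivial x hx.1, by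
        have := E.mul_mem (𝟙 a) (𝟙 a) hs hx.2
        rwa [Category.comp_id] at this⟩⟩)
      (fun n => inf_le_inf_right _ (hle n))
    refine ⟨n, fun m hm => le_antisymm (antitone_nat_of_succ_le hle hm) fun x hx => ?_⟩
    rw [← E.sum_one_mul x]
    refine sum_mem fun b _ => ?_
    have hmem := E.one_mul_mul_one_mem_hom a b x
    rw [mul_assoc, hIa n x hx] at hmem
    by_cases hab : Nonempty (a ⟶ b)
    · obtain ⟨p⟩ := hab
      have hp : E.hom a b ≤ E.comp p := by
        refine iSup_le fun q => ?_
        have hq : q ≫ Groupoid.inv p = 𝟙 a := hend a (q ≫ Groupoid.inv p)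
        have : q = p := by
          rw [← Category.comp_id q, ← Groupoid.inv_comp p, ← Category.assoc, hq,
            Category.id_comp]
        rw [this]
      have key := map_mem_of_mem_sMul (hE.one_mem_sMul p)
        (AddMonoidHom.mulRight (E.one b * x)) (Q := I m) (by
          intro t _ s hs
          have hsx : s * (E.one b * x) ∈ I n ⊓ E.comp (𝟙 a) := by
            refine ⟨(hI n).2 _ trivial _ ((hI n).2 _ trivial x hx), ?_⟩
            have := E.mul_mem (Groupoid.inv p) p hs (hp hmem)
            rwa [Groupoid.comp_inv] at this
          rw [← hn m hm] at hsx
          have := (hI m).2 t trivial _ hsx.1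
          simpa [mul_assoc] using this)
      simpa [← mul_assoc, E.one_mul_one] using key
    · rw [not_nonempty_iff] at hab
      rw [hom, iSup_of_empty, AddSubgroup.mem_bot] at hmem
      rw [hmem]
      exact zero_mem _
  have hsub : ∀ (s : Finset G) (I : ℕ → AddSubgroup S), (∀ n, IsLeftIdealIn ⊤ (I n)) →
      (∀ n, I (n + 1) ≤ I n) → (∀ n, ∀ x ∈ I n, ∀ a ∉ s, x * E.one a = 0) →
      ∃ n, ∀ m, n ≤ m → I m = I n := by
    intro s
    induction s using Finset.induction_on with
    | empty =>
      intro I hI hle hIs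
      refine ⟨0, fun m _ => ?_⟩
      have hbot : ∀ n, I n = ⊥ := by
        refine fun n => (AddSubgroup.eq_bot_iff_forall _).2 fun x hx => ?_
        rw [← E.sum_mul_one x]
        exact Finset.sum_eq_zero fun a _ => hIs n x hx a (by simp)
      rw [hbot, hbot]
    | insert a s _ ih =>
      intro I hI hle hIs
      obtain ⟨n₁, hn₁⟩ := ih (fun n => I n ⊓ (AddMonoidHom.mulRight (E.one a)).ker)
        (fun n => ⟨le_top, fun t _ x hx => ⟨(hI n).2 t trivial x hx.1, by
          have h0 : x * E.one a = 0 := hx.2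
          change t * x * E.one a = 0
          rw [mul_assoc, h0, mul_zero]⟩⟩)
        (fun n => inf_le_inf_right _ (hle n))
        (fun n x hx b hb => by
          by_cases hba : b = a
          · rw [hba]
            exact hx.2
          · exact hIs n x hx.1 b (by simp [hba, hb]))
      obtain ⟨n₂, hn₂⟩ := hcol a (fun n => (I n).map (AddMonoidHom.mulRight (E.one a)))
        (fun n => ⟨le_top, by
          rintro t _ _ ⟨x, hx, rfl⟩
          exact ⟨t * x, (hI n).2 t trivial x hx, mul_assoc _ _ _⟩⟩)
        (fun n => AddSubgroup.map_mono (hle n))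
        (by
          rintro n _ ⟨x, _, rfl⟩
          change x * E.one a * E.one a = x * E.one a
          rw [mul_assoc, E.one_mul_one])
      have hanti := antitone_nat_of_succ_le hle
      refine ⟨max n₁ n₂, fun m hm => le_antisymm (hanti hm) fun x hx => ?_⟩
      have hxa : x * E.one a ∈ (I m).map (AddMonoidHom.mulRight (E.one a)) := by
        rw [hn₂ m (by omega)]
        exact ⟨x, hanti (le_max_right n₁ n₂) hx, rfl⟩
      obtain ⟨y, hy, hyx⟩ := hxa
      replace hyx : y * E.one a = x * E.one a := hyx
      have hdiff : x - y ∈ I n₁ ⊓ (AddMonoidHom.mulRight (E.one a)).ker := by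
        refine ⟨hanti (le_max_left n₁ n₂) (sub_mem hx (hanti hm hy)), ?_⟩
        change (x - y) * E.one a = 0
        rw [sub_mul, hyx, sub_self]
      rw [← hn₁ m (by omega)] at hdiff
      have := add_mem hdiff.1 hy
      rwa [sub_add_cancel] at this
  intro I hI hle
  exact hsub Finset.univ I hI hle (by simp)

theorem isLeftArtinian_iff
    (htf : ∀ (a : G) (g : End a) (n : ℕ), 0 < n → g ^ n = 1 → g = 1)
    {E : ObjectUnitalGrading G S} (hE : E.IsStronglyGraded) :
    IsLeftArtinian S ↔
      (Finite G ∧ ∀ a : G, LeftArtinianOn (E.comp (𝟙 a)) ∧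
        IsFGLeftModuleIn (E.comp (𝟙 a)) (E.hom a a)) := by
  constructor
  · intro h
    refine ⟨E.finite_of_isLeftArtinian h, fun a => ⟨E.leftArtinianOn_comp_id h a, ?_⟩⟩
    rw [E.hom_self_eq_comp_id (end_eq_one_of_isLeftArtinian htf hE h)]
    refine ⟨{E.one a}, by simpa using E.one_mem a, fun x hx => ?_⟩
    rw [AddSubgroup.mem_sInf]
    rintro M ⟨hM, hsmul⟩
    rw [← E.mul_one_mem (𝟙 a) x hx]
    exact hsmul x hx _ (hM (by simp))
  · rintro ⟨_, h⟩
    exact isLeftArtinian_of_end_eq_one hE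
      (fun a => end_eq_one_of_isFGLeftModuleIn htf hE (h a).2) fun a => (h a).1

/-- The grading of the opposite ring obtained by inverting the morphisms of the groupoid. -/
def op (E : ObjectUnitalGrading G S) : ObjectUnitalGrading G Sᵐᵒᵖ where
  comp g := (MulOpposite.opAddEquiv : S ≃+ Sᵐᵒᵖ).mapAddSubgroup (E.comp (Groupoid.inv g))
  indep := by
    have hinj : Function.Injective fun p : Σ a : G, Σ b : G, a ⟶ b =>
        (⟨p.2.1, p.1, Groupoid.inv p.2.2⟩ : Σ a : G, Σ b : G, a ⟶ b) := by
      refine Function.LeftInverse.injective (g := fun p => ⟨p.2.1, p.1, Groupoid.inv p.2.2⟩) ?_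
      rintro ⟨a, b, g⟩
      simp
    exact (E.indep.comp hinj).map_orderIso (MulOpposite.opAddEquiv : S ≃+ Sᵐᵒᵖ).mapAddSubgroup
  span := by
    rw [← OrderIso.map_iSup, map_eq_top_iff, eq_top_iff, ← E.span]
    refine iSup_le fun p => ?_
    refine le_trans (le_of_eq ?_) (le_iSup (fun p : Σ a : G, Σ b : G, a ⟶ b =>
      E.comp (Groupoid.inv p.2.2)) ⟨p.2.1, p.1, Groupoid.inv p.2.2⟩)
    simp
  mul_mem := by
    rintro a b c g h _ _ ⟨x, hx, rfl⟩ ⟨y, hy, rfl⟩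
    refine ⟨y * x, ?_, rfl⟩
    have := E.mul_mem (Groupoid.inv h) (Groupoid.inv g) hy hx
    rwa [show Groupoid.inv (h ≫ g) = Groupoid.inv g ≫ Groupoid.inv h by simp]
  mul_eq_zero := by
    rintro a b a' b' g h _ _ ⟨x, hx, rfl⟩ ⟨y, hy, rfl⟩ hne
    exact congrArg MulOpposite.op
      (E.mul_eq_zero (Groupoid.inv h) (Groupoid.inv g) hy hx hne.symm)
  one a := MulOpposite.op (E.one a)
  one_mem a := ⟨E.one a, by simpa using E.one_mem a, rfl⟩
  one_ne_zero a h := E.one_ne_zero a (MulOpposite.op_injective h)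
  one_mul_mem := by
    rintro a b g _ ⟨x, hx, rfl⟩
    exact congrArg MulOpposite.op (E.mul_one_mem _ x hx)
  mul_one_mem := by
    rintro a b g _ ⟨x, hx, rfl⟩
    exact congrArg MulOpposite.op (E.one_mul_mem _ x hx)

theorem op_comp (E : ObjectUnitalGrading G S) {a b : G} (g : a ⟶ b) :
    E.op.comp g =
      (MulOpposite.opAddEquiv : S ≃+ Sᵐᵒᵖ).mapAddSubgroup (E.comp (Groupoid.inv g)) :=
  rfl

theorem op_comp_id (E : ObjectUnitalGrading G S) (a : G) :
    E.op.comp (𝟙 a) =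
      (MulOpposite.opAddEquiv : S ≃+ Sᵐᵒᵖ).mapAddSubgroup (E.comp (𝟙 a)) := by
  rw [op_comp]
  simp

theorem op_hom_self (E : ObjectUnitalGrading G S) (a : G) :
    E.op.hom a a =
      (MulOpposite.opAddEquiv : S ≃+ Sᵐᵒᵖ).mapAddSubgroup (E.hom a a) := by
  rw [hom, hom, OrderIso.map_iSup]
  exact (Equiv.iSup_comp (g := fun g : a ⟶ a =>
    (MulOpposite.opAddEquiv : S ≃+ Sᵐᵒᵖ).mapAddSubgroup (E.comp g))
    (Function.Involutive.toPerm (fun g : a ⟶ a => Groupoid.inv g) fun g => by simp))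

theorem sMul_mapAddSubgroup_op (A B : AddSubgroup S) :
    sMul ((MulOpposite.opAddEquiv : S ≃+ Sᵐᵒᵖ).mapAddSubgroup A)
        ((MulOpposite.opAddEquiv : S ≃+ Sᵐᵒᵖ).mapAddSubgroup B) =
      (MulOpposite.opAddEquiv : S ≃+ Sᵐᵒᵖ).mapAddSubgroup (sMul B A) := by
  change _ = AddSubgroup.map _ (AddSubgroup.closure _)
  rw [AddMonoidHom.map_closure, sMul]
  congr 1
  ext x
  constructor
  · rintro ⟨_, ⟨a, ha, rfl⟩, _, ⟨b, hb, rfl⟩, rfl⟩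
    exact ⟨b * a, ⟨b, hb, a, ha, rfl⟩, rfl⟩
  · rintro ⟨_, ⟨b, hb, a, ha, rfl⟩, rfl⟩
    exact ⟨_, ⟨a, ha, rfl⟩, _, ⟨b, hb, rfl⟩, rfl⟩

theorem IsStronglyGraded.op {E : ObjectUnitalGrading G S} (hE : E.IsStronglyGraded) :
    E.op.IsStronglyGraded := by
  intro a b c g h
  rw [op_comp, op_comp, op_comp, sMul_mapAddSubgroup_op, hE]
  simp

end Groupoid

end ObjectUnitalGrading

section Opposite

variable {S : Type*} [NonUnitalRing S]

theorem isRightIdealIn_iff_op (C I : AddSubgroup S) :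
    IsRightIdealIn C I ↔
      IsLeftIdealIn ((MulOpposite.opAddEquiv : S ≃+ Sᵐᵒᵖ).mapAddSubgroup C)
        ((MulOpposite.opAddEquiv : S ≃+ Sᵐᵒᵖ).mapAddSubgroup I) := by
  refine and_congr (OrderIso.le_iff_le _).symm ⟨?_, ?_⟩
  · rintro h _ ⟨s, hs, rfl⟩ _ ⟨x, hx, rfl⟩
    exact ⟨x * s, h s hs x hx, rfl⟩
  · intro h s hs x hx
    obtain ⟨y, hy, hyx⟩ := h _ ⟨s, hs, rfl⟩ _ ⟨x, hx, rfl⟩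
    have : y = x * s := MulOpposite.op_injective hyx
    rwa [← this]

theorem rightArtinianOn_iff_op (C : AddSubgroup S) :
    RightArtinianOn C ↔
      LeftArtinianOn ((MulOpposite.opAddEquiv : S ≃+ Sᵐᵒᵖ).mapAddSubgroup C) :=
  DCCOn.congr _ (isRightIdealIn_iff_op C)

theorem isRightArtinian_iff_op : IsRightArtinian S ↔ IsLeftArtinian Sᵐᵒᵖ := by
  rw [IsRightArtinian, rightArtinianOn_iff_op, map_top]
  rfl

theorem isFGRightModuleIn_iff_op (C H : AddSubgroup S) :
    IsFGRightModuleIn C H ↔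
      IsFGLeftModuleIn ((MulOpposite.opAddEquiv : S ≃+ Sᵐᵒᵖ).mapAddSubgroup C)
        ((MulOpposite.opAddEquiv : S ≃+ Sᵐᵒᵖ).mapAddSubgroup H) := by
  constructor
  · rintro ⟨F, hFH, hF⟩
    refine ⟨F.map MulOpposite.opEquiv.toEmbedding, ?_, ?_⟩
    · intro x hx
      obtain ⟨y, hy, rfl⟩ := Finset.mem_map.1 (Finset.mem_coe.1 hx)
      exact ⟨y, hFH hy, rfl⟩
    · rintro _ ⟨x, hx, rfl⟩
      rw [AddSubgroup.mem_sInf]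
      rintro M ⟨hFM, hM⟩
      refine AddSubgroup.mem_sInf.1 (hF x hx)
        (M.comap (MulOpposite.opAddEquiv : S ≃+ Sᵐᵒᵖ).toAddMonoidHom) ⟨?_, ?_⟩
      · intro y hy
        exact hFM (Finset.mem_coe.2 (Finset.mem_map_of_mem _ hy))
      · intro s hs y hy
        exact hM _ ⟨s, hs, rfl⟩ _ hy
  · rintro ⟨F, hFH, hF⟩
    refine ⟨F.map MulOpposite.opEquiv.symm.toEmbedding, ?_, ?_⟩
    · intro x hx
      obtain ⟨y, hy, rfl⟩ := Finset.mem_map.1 (Finset.mem_coe.1 hx)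
      obtain ⟨z, hz, rfl⟩ := hFH hy
      exact hz
    · intro x hx
      rw [AddSubgroup.mem_sInf]
      rintro M ⟨hFM, hM⟩
      obtain ⟨y, hy, hyx⟩ := AddSubgroup.mem_sInf.1 (hF _ ⟨x, hx, rfl⟩)
        (M.map (MulOpposite.opAddEquiv : S ≃+ Sᵐᵒᵖ).toAddMonoidHom) ⟨by
          intro y hy
          exact ⟨MulOpposite.unop y, hFM (Finset.mem_coe.2 (Finset.mem_map_of_mem _ hy)), rfl⟩, by
          rintro _ ⟨s, hs, rfl⟩ _ ⟨y, hy, rfl⟩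
          exact ⟨y * s, hM s hs y hy, rfl⟩⟩
      have : y = x := MulOpposite.op_injective hyx
      rwa [← this]

end Opposite

theorem statement_15 {G : Type*} [Groupoid G]
    (htf : ∀ (a : G) (g : CategoryTheory.End a) (n : ℕ), 0 < n → g ^ n = 1 → g = 1)
    {S : Type*} [NonUnitalRing S] (E : ObjectUnitalGrading G S) (hE : E.IsStronglyGraded) :
    (IsLeftArtinian S ↔
      (Finite G ∧ ∀ a : G, LeftArtinianOn (E.comp (𝟙 a)) ∧
        IsFGLeftModuleIn (E.comp (𝟙 a)) (E.hom a a))) ∧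
    (IsRightArtinian S ↔
      (Finite G ∧ ∀ a : G, RightArtinianOn (E.comp (𝟙 a)) ∧
        IsFGRightModuleIn (E.comp (𝟙 a)) (E.hom a a))) := by
  refine ⟨ObjectUnitalGrading.isLeftArtinian_iff htf hE, ?_⟩
  rw [isRightArtinian_iff_op, ObjectUnitalGrading.isLeftArtinian_iff htf hE.op]
  simp only [rightArtinianOn_iff_op, isFGRightModuleIn_iff_op, E.op_comp_id, E.op_hom_self]

end ChainPaper
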